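/- arXiv:2201.01214 — 9 statements merged into one kernel-verified Lean document; each statement's English description precedes it below -/
import Mathlib

section
/- Let n, m, p be positive integers, H an n×n real matrix whose quadratic form is positive definite (ζᵀHζ > 0 for every nonzero ζ ∈ ℝⁿ), A_E an m×n real matrix, A_I a p×n real matrix, and s̄, z̄ ∈ ℝᵖ. Assume: (A1) the collection of vectors consisting of all rows of A_E together with those rows aᵢ of A_I for which s̄ᵢ = 0 is linearly independent; (A3) for each i ∈ {1,…,p}, z̄ᵢ + s̄ᵢ > 0 and z̄ᵢ·s̄ᵢ = 0. Then the (n+m+3p)×(n+m+3p) block matrix M = [[H, A_Eᵀ, −A_Iᵀ, 0, 0], [A_E, 0, 0, 0, 0], [A_I, 0, 0, −I, 0], [0, 0, I, 0, −I], [0, 0, 0, diag(z̄), diag(s̄)]] is nonsingular (equivalently, Mv = 0 implies v = 0). -/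
open Matrix

/-- The `(n+m+3p) × (n+m+3p)` Jacobian of the KKT map at an optimal solution:
`M = [[H, A_Eᵀ, −A_Iᵀ, 0, 0], [A_E, 0, 0, 0, 0], [A_I, 0, 0, −I, 0],
[0, 0, I, 0, −I], [0, 0, 0, diag z̄, diag s̄]]`. -/
def kktJacobian (n m p : ℕ)
    (H : Matrix (Fin n) (Fin n) ℝ) (AE : Matrix (Fin m) (Fin n) ℝ)
    (AI : Matrix (Fin p) (Fin n) ℝ) (zbar sbar : Fin p → ℝ) :
    Matrix (Fin n ⊕ Fin m ⊕ Fin p ⊕ Fin p ⊕ Fin p)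
      (Fin n ⊕ Fin m ⊕ Fin p ⊕ Fin p ⊕ Fin p) ℝ :=
  Matrix.of fun i j =>
    match i, j with
    -- row block 1: [H, A_Eᵀ, −A_Iᵀ, 0, 0]
    | Sum.inl i, Sum.inl j => H i j
    | Sum.inl i, Sum.inr (Sum.inl j) => AE j i
    | Sum.inl i, Sum.inr (Sum.inr (Sum.inl j)) => -(AI j i)
    | Sum.inl _, Sum.inr (Sum.inr (Sum.inr _)) => 0
    -- row block 2: [A_E, 0, 0, 0, 0]
    | Sum.inr (Sum.inl i), Sum.inl j => AE i j
    | Sum.inr (Sum.inl _), Sum.inr _ => 0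
    -- row block 3: [A_I, 0, 0, −I, 0]
    | Sum.inr (Sum.inr (Sum.inl i)), Sum.inl j => AI i j
    | Sum.inr (Sum.inr (Sum.inl i)), Sum.inr (Sum.inr (Sum.inr (Sum.inl j))) =>
        if i = j then -1 else 0
    | Sum.inr (Sum.inr (Sum.inl _)), Sum.inr _ => 0
    -- row block 4: [0, 0, I, 0, −I]
    | Sum.inr (Sum.inr (Sum.inr (Sum.inl i))), Sum.inr (Sum.inr (Sum.inl j)) =>
        if i = j then 1 else 0
    | Sum.inr (Sum.inr (Sum.inr (Sum.inl i))), Sum.inr (Sum.inr (Sum.inr (Sum.inr j))) =>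
        if i = j then -1 else 0
    | Sum.inr (Sum.inr (Sum.inr (Sum.inl _))), _ => 0
    -- row block 5: [0, 0, 0, diag z̄, diag s̄]
    | Sum.inr (Sum.inr (Sum.inr (Sum.inr i))), Sum.inr (Sum.inr (Sum.inr (Sum.inl j))) =>
        if i = j then zbar i else 0
    | Sum.inr (Sum.inr (Sum.inr (Sum.inr i))), Sum.inr (Sum.inr (Sum.inr (Sum.inr j))) =>
        if i = j then sbar i else 0
    | Sum.inr (Sum.inr (Sum.inr (Sum.inr _))), _ => 0

/-- The linear system `M v = 0` for the KKT Jacobian `M`, written block row by block row. -/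
theorem kktJacobian_mulVec_eq_zero {n m p : ℕ} {H : Matrix (Fin n) (Fin n) ℝ}
    {AE : Matrix (Fin m) (Fin n) ℝ} {AI : Matrix (Fin p) (Fin n) ℝ} {zbar sbar : Fin p → ℝ}
    {x : Fin n → ℝ} {y : Fin m → ℝ} {z s w : Fin p → ℝ}
    (h : (kktJacobian n m p H AE AI zbar sbar).mulVec
      (Sum.elim x (Sum.elim y (Sum.elim z (Sum.elim s w)))) = 0) :
    H *ᵥ x + y ᵥ* AE - z ᵥ* AI = 0 ∧ AE *ᵥ x = 0 ∧ AI *ᵥ x = s ∧ z = w ∧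
      ∀ i, zbar i * s i + sbar i * w i = 0 := by
  refine ⟨funext fun i => ?_, funext fun i => ?_, funext fun i => ?_, funext fun i => ?_,
    fun i => ?_⟩
  · have := congrFun h (.inl i)
    simp [kktJacobian, mulVec, vecMul, dotProduct] at this ⊢
    simp only [mul_comm (y _), mul_comm (z _)]
    linarith
  · simpa [kktJacobian, mulVec, dotProduct] using congrFun h (.inr (.inl i))
  · have := congrFun h (.inr (.inr (.inl i)))
    simp [kktJacobian, mulVec, dotProduct] at this ⊢
    linarith
  · have := congrFun h (.inr (.inr (.inr (.inl i))))
    simp [kktJacobian, mulVec, dotProduct] at this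
    linarith
  · simpa [kktJacobian, mulVec, dotProduct] using congrFun h (.inr (.inr (.inr (.inr i))))

/-- Theorem 2.1: under positive definiteness of `H`, the linear independence
constraint qualification (A1) and strict complementarity (A3), the KKT
Jacobian is nonsingular, i.e. `M v = 0` implies `v = 0`. -/
theorem kktJacobian_nonsingular (n m p : ℕ)
    (hn : 0 < n) (hm : 0 < m) (hp : 0 < p)
    (H : Matrix (Fin n) (Fin n) ℝ)
    (hH : ∀ ζ : Fin n → ℝ, ζ ≠ 0 → 0 < ζ ⬝ᵥ H.mulVec ζ)
    (AE : Matrix (Fin m) (Fin n) ℝ) (AI : Matrix (Fin p) (Fin n) ℝ)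
    (sbar zbar : Fin p → ℝ)
    (hA1 : LinearIndependent ℝ
      (Sum.elim (fun j : Fin m => AE j)
        (fun i : {i : Fin p // sbar i = 0} => AI i.1)))
    (hA3 : ∀ i : Fin p, 0 < zbar i + sbar i ∧ zbar i * sbar i = 0) :
    ∀ v : Fin n ⊕ Fin m ⊕ Fin p ⊕ Fin p ⊕ Fin p → ℝ,
      (kktJacobian n m p H AE AI zbar sbar).mulVec v = 0 → v = 0 := by
  intro v hv
  obtain ⟨x, y, z, s, w, rfl⟩ : ∃ x y z s w,
      v = Sum.elim x (Sum.elim y (Sum.elim z (Sum.elim s w))) :=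
    ⟨fun i => v (.inl i), fun i => v (.inr (.inl i)), fun i => v (.inr (.inr (.inl i))),
      fun i => v (.inr (.inr (.inr (.inl i)))), fun i => v (.inr (.inr (.inr (.inr i)))),
      by ext (i | i | i | i | i) <;> rfl⟩
  obtain ⟨hstat, hE, hI, rfl, hcomp⟩ := kktJacobian_mulVec_eq_zero hv
  have hactive : ∀ i, sbar i = 0 → s i = 0 := fun i hi => by
    have hz : zbar i ≠ 0 := by linarith [(hA3 i).1]
    simpa [hi, hz] using hcomp i
  have hinactive : ∀ i, sbar i ≠ 0 → z i = 0 := fun i hi => by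
    have hz : zbar i = 0 := (mul_eq_zero.1 (hA3 i).2).resolve_right hi
    simpa [hi, hz] using hcomp i
  have hzs : z ⬝ᵥ s = 0 := Finset.sum_eq_zero fun i _ => by
    by_cases hi : sbar i = 0
    · rw [hactive i hi, mul_zero]
    · rw [hinactive i hi, zero_mul]
  have hx : x = 0 := by
    by_contra hne
    have hpos := hH x hne
    have hdot := congrArg (x ⬝ᵥ ·) hstat
    simp only [dotProduct_sub, dotProduct_add, dotProduct_zero, dotProduct_comm x (_ ᵥ* _),
      ← dotProduct_mulVec, hE, hI, hzs] at hdot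
    linarith
  subst hx
  have hs : s = 0 := by rw [← hI, mulVec_zero]
  have hcombination : ∑ k, Sum.elim y (fun i : {i // sbar i = 0} => -z i.1) k •
      Sum.elim (fun j : Fin m => AE j) (fun i : {i // sbar i = 0} => AI i.1) k = 0 := by
    have hsum : ∑ i : {i // sbar i = 0}, z i.1 • AI i.1 = ∑ i, z i • AI i := by
      refine Fintype.sum_of_injective Subtype.val Subtype.val_injective _ _ (fun i hi => ?_)
        fun _ => rfl
      rw [hinactive i fun h => hi ⟨⟨i, h⟩, rfl⟩, zero_smul]
    simp only [Fintype.sum_sum_type, Sum.elim_inl, Sum.elim_inr, neg_smul,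
      Finset.sum_neg_distrib, hsum]
    rw [mulVec_zero, zero_add, vecMul_eq_sum, vecMul_eq_sum] at hstat
    rw [← sub_eq_add_neg]
    exact hstat
  have hzero := Fintype.linearIndependent_iff.1 hA1 _ hcombination
  have hy : y = 0 := funext fun j => hzero (.inl j)
  have hz : z = 0 := funext fun i => by
    by_cases hi : sbar i = 0
    · simpa using hzero (.inr ⟨i, hi⟩)
    · exact hinactive i hi
  subst hy hz hs
  ext (i | i | i | i | i) <;> rfl
end

section
/- Let H be an n×n real matrix, A_E an m×n real matrix, A_I a p×n real matrix, b_E ∈ ℝᵐ, b_I ∈ ℝᵖ, and let x, ẋ, ẍ ∈ ℝⁿ, y, ẏ, ÿ ∈ ℝᵐ, w, ẇ, ẅ, s, ṡ, s̈ ∈ ℝᵖ satisfy: H ẋ + A_Eᵀ ẏ − A_Iᵀ ẇ = H x + A_Eᵀ y − A_Iᵀ w; A_E ẋ = A_E x − b_E; A_I ẋ − ṡ = A_I x − s − b_I; H ẍ + A_Eᵀ ÿ − A_Iᵀ ẅ = 0; A_E ẍ = 0; A_I ẍ − s̈ = 0. For α ∈ ℝ define x⁺ = x − ẋ·sin α +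 ẍ·(1 − cos α), and similarly y⁺, w⁺, s⁺. Then: (a) H x⁺ + A_Eᵀ y⁺ − A_Iᵀ w⁺ = (1 − sin α)(H x + A_Eᵀ y − A_Iᵀ w); (b) A_E x⁺ − b_E = (1 − sin α)(A_E x − b_E); (c) A_I x⁺ − s⁺ − b_I = (1 − sin α)(A_I x − s − b_I). -/
open Matrix

/-- Proposition 3.1 (single-iteration form): the residuals contract by the
factor `(1 − sin α)` along the ellipsoidal arc. -/
theorem residual_contraction (n m p : ℕ)
    (H : Matrix (Fin n) (Fin n) ℝ) (AE : Matrix (Fin m) (Fin n) ℝ)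
    (AI : Matrix (Fin p) (Fin n) ℝ) (bE : Fin m → ℝ) (bI : Fin p → ℝ)
    (x xd xdd : Fin n → ℝ) (y yd ydd : Fin m → ℝ)
    (w wd wdd s sd sdd : Fin p → ℝ)
    (h1 : H.mulVec xd + AEᵀ.mulVec yd - AIᵀ.mulVec wd =
          H.mulVec x + AEᵀ.mulVec y - AIᵀ.mulVec w)
    (h2 : AE.mulVec xd = AE.mulVec x - bE)
    (h3 : AI.mulVec xd - sd = AI.mulVec x - s - bI)
    (h4 : H.mulVec xdd + AEᵀ.mulVec ydd - AIᵀ.mulVec wdd = 0)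
    (h5 : AE.mulVec xdd = 0)
    (h6 : AI.mulVec xdd - sdd = 0)
    (α : ℝ)
    (xp : Fin n → ℝ) (hxp : xp = x - Real.sin α • xd + (1 - Real.cos α) • xdd)
    (yp : Fin m → ℝ) (hyp : yp = y - Real.sin α • yd + (1 - Real.cos α) • ydd)
    (wp : Fin p → ℝ) (hwp : wp = w - Real.sin α • wd + (1 - Real.cos α) • wdd)
    (sp : Fin p → ℝ) (hsp : sp = s - Real.sin α • sd + (1 - Real.cos α) • sdd) :
    H.mulVec xp + AEᵀ.mulVec yp - AIᵀ.mulVec wp =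
        (1 - Real.sin α) • (H.mulVec x + AEᵀ.mulVec y - AIᵀ.mulVec w) ∧
    AE.mulVec xp - bE = (1 - Real.sin α) • (AE.mulVec x - bE) ∧
    AI.mulVec xp - sp - bI = (1 - Real.sin α) • (AI.mulVec x - s - bI) := by
  subst hxp hyp hwp hsp
  simp only [mulVec_add, mulVec_sub, mulVec_smul]
  refine ⟨?_, ?_, ?_⟩
  · linear_combination (norm := module) (-Real.sin α) • h1 + (1 - Real.cos α) • h4
  · linear_combination (norm := module) (-Real.sin α) • h2 + (1 - Real.cos α) • h5
  · linear_combination (norm := module) (-Real.sin α) • h3 + (1 - Real.cos α) • h6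
end

section
/- Let p be a positive integer, s, z, ṡ, ż, p_s, p_z, q_s, q_z ∈ ℝᵖ, σ, α ∈ ℝ, and μ = sᵀz/p. Assume (componentwise, where ∘ denotes the Hadamard product and e the all-ones vector): z ∘ ṡ + s ∘ ż = z ∘ s; z ∘ p_s + s ∘ p_z = μ·e; z ∘ q_s + s ∘ q_z = −2 ż ∘ ṡ. Set s̈ = σ·p_s + q_s, z̈ = σ·p_z + q_z, s(α) = s − ṡ·sin α + s̈·(1 − cos α), and z(α) = z − ż·sin α + z̈·(1 − cos α). Then z(α)ᵀ s(α) = pμ(1 − sin α) + σ·pμ·(1 − cos α) − żᵀṡ·(1 − cos α)² − (żᵀ s̈ + ṡᵀ z̈)·sin α·(1 − cos α) + z̈ᵀ s̈·(1 − cos α)². -/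
open Matrix

/-- Exact expansion of the updated duality gap (underlying Proposition 3.2). -/
theorem duality_gap_expansion (p : ℕ) (hp : 0 < p)
    (s z sd zd ps pz qs qz : Fin p → ℝ) (σ α μ : ℝ)
    (hμ : μ = s ⬝ᵥ z / p)
    (h1 : z * sd + s * zd = z * s)
    (h2 : z * ps + s * pz = fun _ => μ)
    (h3 : z * qs + s * qz = -(2 : ℝ) • (zd * sd))
    (sdd zdd sa za : Fin p → ℝ)
    (hsdd : sdd = σ • ps + qs) (hzdd : zdd = σ • pz + qz)
    (hsa : sa = s - Real.sin α • sd + (1 - Real.cos α) • sdd)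
    (hza : za = z - Real.sin α • zd + (1 - Real.cos α) • zdd) :
    za ⬝ᵥ sa =
      (p : ℝ) * μ * (1 - Real.sin α) + σ * ((p : ℝ) * μ) * (1 - Real.cos α)
        - zd ⬝ᵥ sd * (1 - Real.cos α) ^ 2
        - (zd ⬝ᵥ sdd + sd ⬝ᵥ zdd) * (Real.sin α * (1 - Real.cos α))
        + zdd ⬝ᵥ sdd * (1 - Real.cos α) ^ 2 := by
  have gap : (p : ℝ) * μ = ∑ i, s i * z i := by
    rw [hμ, mul_div_cancel₀ _ (by positivity)]
    rfl
  have const : (p : ℝ) * μ = ∑ _i : Fin p, μ := by simp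
  have gap' : (p : ℝ) * μ * (1 - Real.sin α) = ∑ i, s i * z i * (1 - Real.sin α) := by
    rw [gap, Finset.sum_mul]
  rw [gap', const]
  simp only [dotProduct, Finset.mul_sum, Finset.sum_mul, ← Finset.sum_add_distrib,
    ← Finset.sum_sub_distrib]
  refine Finset.sum_congr rfl fun i _ => ?_
  have e1 := congrFun h1 i
  have e2 := congrFun h2 i
  have e3 := congrFun h3 i
  subst hsa hza hsdd hzdd
  simp only [Pi.add_apply, Pi.sub_apply, Pi.mul_apply, Pi.smul_apply, smul_eq_mul]
    at e1 e2 e3 ⊢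
  linear_combination -Real.sin α * e1 + (1 - Real.cos α) * σ * e2 + (1 - Real.cos α) * e3 +
    zd i * sd i * Real.sin_sq_add_cos_sq α
end

section
/- Let s, z, ṡ, ż, s̈, z̈, σ, μ, θ, α be real numbers satisfying s·ż + z·ṡ = z·s, z·s̈ + s·z̈ = σ·μ − 2·ṡ·ż, and z·s ≥ θ·μ. Then (s − ṡ·sin α + s̈·(1 − cos α))·(z − ż·sin α + z̈·(1 − cos α)) ≥ θ·μ·(1 − sin α) + σ·μ·(1 − cos α) − (s̈·ż + ṡ·z̈)·sin α·(1 − cos α) + (s̈·z̈ − ṡ·ż)·(1 − cos α)². -/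
/-- Proposition 3.4 (componentwise inequality): lower bound for the product
`s(α) z(α)` along the ellipsoidal arc under the proximity condition `z s ≥ θ μ`. -/
theorem arc_product_lower_bound
    (s z sd zd sdd zdd σ μ θ α : ℝ)
    (h1 : s * zd + z * sd = z * s)
    (h2 : z * sdd + s * zdd = σ * μ - 2 * sd * zd)
    (h3 : z * s ≥ θ * μ) :
    (s - sd * Real.sin α + sdd * (1 - Real.cos α)) *
      (z - zd * Real.sin α + zdd * (1 - Real.cos α)) ≥
    θ * μ * (1 - Real.sin α) + σ * μ * (1 - Real.cos α)
      - (sdd * zd + sd * zdd) * Real.sin α * (1 - Real.cos α)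
      + (sdd * zdd - sd * zd) * (1 - Real.cos α) ^ 2 := by
  have hslack : 0 ≤ (z * s - θ * μ) * (1 - Real.sin α) :=
    mul_nonneg (sub_nonneg.mpr h3) (sub_nonneg.mpr (Real.sin_le_one α))
  rw [ge_iff_le, ← sub_nonneg]
  convert hslack using 1
  linear_combination (-Real.sin α) * h1 + (1 - Real.cos α) * h2
    + sd * zd * Real.sin_sq_add_cos_sq α
end

section
/- Let p be a positive integer, s, z ∈ ℝᵖ with sᵢ > 0, zᵢ > 0 for all i, and D the diagonal matrix with Dᵢᵢ = √(sᵢ/zᵢ). Let ν ∈ ℝ, s⁰, s̄, z⁰, z̄ ∈ ℝᵖ, and for i = 1, 2, 3 let δsⁱ, δzⁱ ∈ ℝᵖ satisfy z ∘ δsⁱ + s ∘ δzⁱ = rⁱ and (δsⁱ)ᵀ(δzⁱ) ≥ 0, where r¹ = z ∘ s, r² = −ν·z ∘ (s⁰ − s̄), r³ = −ν·s ∘ (z⁰ − z̄). Define ṡ = δs¹ + δs² + δs³ + ν(s⁰ − s̄) and ż = δz¹ + δz² + δz³ + ν(z⁰ − z̄). Then ‖D⁻¹ ṡ‖ ≤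 √(sᵀz) + ‖D δz²‖ + ‖D⁻¹ δs³‖ and ‖D ż‖ ≤ √(sᵀz) + ‖D δz²‖ + ‖D⁻¹ δs³‖, where ‖·‖ is the Euclidean norm. -/
open Matrix

/-- The Euclidean norm on `Fin p → ℝ`. -/
noncomputable def euclNorm {p : ℕ} (x : Fin p → ℝ) : ℝ :=
  Real.sqrt (∑ i, x i ^ 2)

theorem euclNorm_eq_norm_toLp {p : ℕ} (x : Fin p → ℝ) :
    euclNorm x = ‖WithLp.toLp 2 x‖ := by
  simp [euclNorm, EuclideanSpace.norm_eq]

theorem euclNorm_add_sub_le {p : ℕ} (x y w : Fin p → ℝ) :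
    euclNorm (x + y - w) ≤ euclNorm x + euclNorm y + euclNorm w := by
  simp only [euclNorm_eq_norm_toLp, WithLp.toLp_sub, WithLp.toLp_add]
  exact (norm_sub_le _ _).trans (by gcongr; exact norm_add_le _ _)

/-- A summand having nonnegative inner product with the other one is no longer than the sum. -/
theorem euclNorm_le_euclNorm_add {p : ℕ} (x y : Fin p → ℝ) (h : 0 ≤ x ⬝ᵥ y) :
    euclNorm x ≤ euclNorm (x + y) := by
  apply Real.sqrt_le_sqrt
  have hsum : ∑ i, (x + y) i ^ 2 = ∑ i, x i ^ 2 + 2 * (x ⬝ᵥ y) + ∑ i, y i ^ 2 := by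
    simp only [dotProduct, Finset.mul_sum, ← Finset.sum_add_distrib, Pi.add_apply]
    exact Finset.sum_congr rfl fun i _ => by ring
  have : 0 ≤ ∑ i, y i ^ 2 := Finset.sum_nonneg fun i _ => sq_nonneg _
  linarith

theorem inv_diagonal_of_ne_zero {p : ℕ} (d : Fin p → ℝ) (hd : ∀ i, d i ≠ 0) :
    (Matrix.diagonal d)⁻¹ = Matrix.diagonal fun i => (d i)⁻¹ := by
  apply Matrix.inv_eq_left_inv
  rw [Matrix.diagonal_mul_diagonal, ← Matrix.diagonal_one]
  congr 1
  funext i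
  exact inv_mul_cancel₀ (hd i)

/-- Lemma 4.5 (main estimate): bounds on the scaled first-order directions
`D⁻¹ ṡ` and `D ż` of the infeasible arc-search interior-point algorithm. -/
theorem scaled_first_order_direction_bound (p : ℕ) (hp : 0 < p)
    (s z : Fin p → ℝ) (hs : ∀ i, 0 < s i) (hz : ∀ i, 0 < z i)
    (D : Matrix (Fin p) (Fin p) ℝ)
    (hD : D = Matrix.diagonal fun i => Real.sqrt (s i / z i))
    (ν : ℝ) (s0 sbar z0 zbar : Fin p → ℝ)
    (δs1 δs2 δs3 δz1 δz2 δz3 : Fin p → ℝ)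
    (h1 : z * δs1 + s * δz1 = z * s)
    (h2 : z * δs2 + s * δz2 = -ν • (z * (s0 - sbar)))
    (h3 : z * δs3 + s * δz3 = -ν • (s * (z0 - zbar)))
    (hc1 : 0 ≤ δs1 ⬝ᵥ δz1) (hc2 : 0 ≤ δs2 ⬝ᵥ δz2) (hc3 : 0 ≤ δs3 ⬝ᵥ δz3)
    (sd zd : Fin p → ℝ)
    (hsd : sd = δs1 + δs2 + δs3 + ν • (s0 - sbar))
    (hzd : zd = δz1 + δz2 + δz3 + ν • (z0 - zbar)) :
    euclNorm (D⁻¹.mulVec sd) ≤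
      Real.sqrt (s ⬝ᵥ z) + euclNorm (D.mulVec δz2) + euclNorm (D⁻¹.mulVec δs3) ∧
    euclNorm (D.mulVec zd) ≤
      Real.sqrt (s ⬝ᵥ z) + euclNorm (D.mulVec δz2) + euclNorm (D⁻¹.mulVec δs3) := by
  obtain ⟨d, hd⟩ : ∃ d : Fin p → ℝ, d = fun i => Real.sqrt (s i / z i) := ⟨_, rfl⟩
  have hdpos : ∀ i, 0 < d i := fun i => by
    rw [hd]; exact Real.sqrt_pos.2 (div_pos (hs i) (hz i))
  have hsd2 : ∀ i, s i = d i ^ 2 * z i := fun i => by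
    have := (hz i).ne'
    rw [hd, Real.sq_sqrt (div_pos (hs i) (hz i)).le]
    field_simp
  rw [← hd] at hD
  have hDinv : ∀ x, D⁻¹.mulVec x = fun i => (d i)⁻¹ * x i := fun x => by
    rw [hD, inv_diagonal_of_ne_zero d fun i => (hdpos i).ne']
    funext i
    exact Matrix.mulVec_diagonal _ _ i
  have hDmul : ∀ x, D.mulVec x = fun i => d i * x i := fun x => by
    rw [hD]
    funext i
    exact Matrix.mulVec_diagonal _ _ i
  have hdot : D⁻¹.mulVec δs1 ⬝ᵥ D.mulVec δz1 = δs1 ⬝ᵥ δz1 := by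
    rw [hDinv, hDmul]
    refine Finset.sum_congr rfl fun i _ => ?_
    have := (hdpos i).ne'
    field_simp
  have hnorm : euclNorm (D⁻¹.mulVec δs1 + D.mulVec δz1) = Real.sqrt (s ⬝ᵥ z) := by
    rw [hDinv, hDmul]
    unfold euclNorm
    congr 1
    refine Finset.sum_congr rfl fun i _ => ?_
    have e : z i * δs1 i + s i * δz1 i = z i * s i := congrFun h1 i
    have hd0 := (hdpos i).ne'
    rw [hsd2 i] at e ⊢
    have e' : δs1 i = d i ^ 2 * z i - d i ^ 2 * δz1 i :=
      mul_left_cancel₀ (hz i).ne' (by linear_combination e)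
    simp only [Pi.add_apply]
    rw [e']
    field_simp
    ring
  have hs1 : euclNorm (D⁻¹.mulVec δs1) ≤ Real.sqrt (s ⬝ᵥ z) :=
    hnorm ▸ euclNorm_le_euclNorm_add _ _ (hdot ▸ hc1)
  have hz1 : euclNorm (D.mulVec δz1) ≤ Real.sqrt (s ⬝ᵥ z) := by
    rw [← hnorm, add_comm]
    exact euclNorm_le_euclNorm_add _ _ (by rw [dotProduct_comm, hdot]; exact hc1)
  have hsplit_s : D⁻¹.mulVec sd = D⁻¹.mulVec δs1 + D⁻¹.mulVec δs3 - D.mulVec δz2 := by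
    simp only [hDinv, hDmul]
    funext i
    have e : z i * δs2 i + s i * δz2 i = -ν * (z i * (s0 i - sbar i)) := congrFun h2 i
    have hd0 := (hdpos i).ne'
    rw [hsd2 i] at e
    have e' : δs2 i = -(d i ^ 2 * δz2 i) - ν * (s0 i - sbar i) :=
      mul_left_cancel₀ (hz i).ne' (by linear_combination e)
    simp only [hsd, Pi.add_apply, Pi.sub_apply, Pi.smul_apply, smul_eq_mul]
    rw [e']
    field_simp
    ring
  have hsplit_z : D.mulVec zd = D.mulVec δz1 + D.mulVec δz2 - D⁻¹.mulVec δs3 := by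
    simp only [hDinv, hDmul]
    funext i
    have e : z i * δs3 i + s i * δz3 i = -ν * (s i * (z0 i - zbar i)) := congrFun h3 i
    have hd0 := (hdpos i).ne'
    rw [hsd2 i] at e
    have e' : δs3 i = -(d i ^ 2 * (δz3 i + ν * (z0 i - zbar i))) :=
      mul_left_cancel₀ (hz i).ne' (by linear_combination e)
    simp only [hzd, Pi.add_apply, Pi.sub_apply, Pi.smul_apply, smul_eq_mul]
    rw [e']
    field_simp
    ring
  constructor
  · rw [hsplit_s]
    linarith [euclNorm_add_sub_le (D⁻¹.mulVec δs1) (D⁻¹.mulVec δs3) (D.mulVec δz2)]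
  · rw [hsplit_z]
    linarith [euclNorm_add_sub_le (D.mulVec δz1) (D.mulVec δz2) (D⁻¹.mulVec δs3)]
end

section
/- Let s, s̈, φ be real numbers with s ≥ φ. Define s(α) = s + s̈·(1 − cos α) (the arc value with ṡ = 0). (i) If s + s̈ − φ ≥ 0, then s(α) ≥ φ for all α ∈ [0, π/2]. (ii) If s̈ ≠ 0 and s + s̈ − φ ≤ 0, then s(α) ≥ φ for all α ∈ [0, arccos((s + s̈ − φ)/s̈)]. -/
/-- Case 1a of the appendix: step sizes guaranteeing `s(α) ≥ φ` along the arc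
when `ṡ = 0`. -/
theorem arc_positivity_case1a (s sdd φ : ℝ) (hs : s ≥ φ) :
    (s + sdd - φ ≥ 0 →
      ∀ α ∈ Set.Icc (0 : ℝ) (Real.pi / 2), s + sdd * (1 - Real.cos α) ≥ φ) ∧
    (sdd ≠ 0 → s + sdd - φ ≤ 0 →
      ∀ α ∈ Set.Icc (0 : ℝ) (Real.arccos ((s + sdd - φ) / sdd)),
        s + sdd * (1 - Real.cos α) ≥ φ) := by
  refine ⟨fun h α hα => ?_, fun hne h α hα => ?_⟩
  · have hcos : 0 ≤ Real.cos α :=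
      Real.cos_nonneg_of_mem_Icc ⟨by linarith [hα.1, Real.pi_pos], hα.2⟩
    nlinarith [mul_nonneg (sub_nonneg.2 (Real.cos_le_one α)) h,
      mul_nonneg hcos (sub_nonneg.2 hs)]
  · have hneg : sdd < 0 := lt_of_le_of_ne (by linarith) hne
    have hr0 : 0 ≤ (s + sdd - φ) / sdd := div_nonneg_of_nonpos h hneg.le
    have hr1 : (s + sdd - φ) / sdd ≤ 1 := (div_le_one_of_neg hneg).2 (by linarith)
    have hcos : (s + sdd - φ) / sdd ≤ Real.cos α := by
      rw [← Real.cos_arccos (by linarith) hr1]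
      exact Real.cos_le_cos_of_nonneg_of_le_pi hα.1 (Real.arccos_le_pi _) hα.2
    have hmul := (div_le_iff_of_neg hneg).1 hcos
    linarith
end

section
/- Let s, ṡ, s̈, φ be real numbers with ṡ > 0, s̈ > 0, s ≥ φ, and s + s̈ − φ ≤ R, where R = √(ṡ² + s̈²). Set β = arcsin(s̈/R). Then for every α ∈ [0, arcsin((s + s̈ − φ)/R) − β], we have s − ṡ·sin α + s̈·(1 − cos α) ≥ φ. -/
/-- Case 3a of the appendix: step sizes guaranteeing `s(α) ≥ φ` along the arc
when `ṡ > 0` and `s̈ > 0`. -/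
theorem arc_positivity_case3a (s sd sdd φ : ℝ) (hsd : sd > 0) (hsdd : sdd > 0)
    (hs : s ≥ φ) (R : ℝ) (hR : R = Real.sqrt (sd ^ 2 + sdd ^ 2))
    (hle : s + sdd - φ ≤ R) (β : ℝ) (hβ : β = Real.arcsin (sdd / R)) :
    ∀ α ∈ Set.Icc (0 : ℝ) (Real.arcsin ((s + sdd - φ) / R) - β),
      s - sd * Real.sin α + sdd * (1 - Real.cos α) ≥ φ := by
  rintro α ⟨hα0, hα⟩
  have hpos : 0 < sd ^ 2 + sdd ^ 2 := by positivity
  have hRpos : 0 < R := hR ▸ Real.sqrt_pos.mpr hpos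
  have hRsq : R ^ 2 = sd ^ 2 + sdd ^ 2 := by rw [hR, Real.sq_sqrt hpos.le]
  have hsddR : sdd ≤ R := by nlinarith
  have hsin : Real.sin β = sdd / R := by
    rw [hβ, Real.sin_arcsin]
    · have : 0 < sdd / R := by positivity
      linarith
    · rwa [div_le_one hRpos]
  have hcos : Real.cos β = sd / R := by
    have h : 1 - (sdd / R) ^ 2 = (sd / R) ^ 2 := by
      field_simp
      linarith
    rw [hβ, Real.cos_arcsin, h, Real.sqrt_sq (by positivity)]
  have hβ_lower : -(Real.pi / 2) ≤ β := hβ ▸ Real.neg_pi_div_two_le_arcsin _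
  have hmono : Real.sin (α + β) ≤ (s + sdd - φ) / R := by
    have hx_nonneg : 0 ≤ (s + sdd - φ) / R := div_nonneg (by linarith) hRpos.le
    have hx_le_one : (s + sdd - φ) / R ≤ 1 := by rwa [div_le_one hRpos]
    rw [← Real.sin_arcsin (by linarith) hx_le_one]
    exact Real.sin_le_sin_of_le_of_le_pi_div_two (by linarith)
      (Real.arcsin_le_pi_div_two _) (by linarith)
  rw [le_div_iff₀ hRpos, Real.sin_add, hsin, hcos] at hmono
  have hexpand : (Real.sin α * (sd / R) + Real.cos α * (sdd / R)) * R =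
      sd * Real.sin α + sdd * Real.cos α := by
    field_simp
  linarith
end

section
/- Let s, ṡ, s̈, φ be real numbers with ṡ > 0, s̈ < 0, s ≥ φ, and s + s̈ − φ ≤ R, where R = √(ṡ² + s̈²). Set β = arcsin(−s̈/R). Then for every α ∈ [0, arcsin((s + s̈ − φ)/R) + β], we have s − ṡ·sin α + s̈·(1 − cos α) ≥ φ. -/
/-- Case 4a of the appendix: step sizes guaranteeing `s(α) ≥ φ` along the arc
when `ṡ > 0` and `s̈ < 0`. -/
theorem arc_positivity_case4a (s sd sdd φ : ℝ) (hsd : sd > 0) (hsdd : sdd < 0)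
    (hs : s ≥ φ) (R : ℝ) (hR : R = Real.sqrt (sd ^ 2 + sdd ^ 2))
    (hle : s + sdd - φ ≤ R) (β : ℝ) (hβ : β = Real.arcsin (-sdd / R)) :
    ∀ α ∈ Set.Icc (0 : ℝ) (Real.arcsin ((s + sdd - φ) / R) + β),
      s - sd * Real.sin α + sdd * (1 - Real.cos α) ≥ φ := by
  intro α ⟨hα0, hα⟩
  have hRsq : R ^ 2 = sd ^ 2 + sdd ^ 2 := by rw [hR, Real.sq_sqrt (by positivity)]
  have hRpos : 0 < R := by rw [hR]; positivity
  have hsddR : -sdd ≤ R := abs_le_of_sq_le_sq' (by nlinarith) hRpos.le |>.2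
  have hsin : Real.sin β = -sdd / R := by
    rw [hβ, Real.sin_arcsin]
    · exact le_trans (by norm_num) (div_nonneg (by linarith) hRpos.le)
    · rwa [div_le_one hRpos]
  have hcos : Real.cos β = sd / R := by
    have h : 1 - (-sdd / R) ^ 2 = (sd / R) ^ 2 := by
      field_simp
      linarith
    rw [hβ, Real.cos_arcsin, h, Real.sqrt_sq (by positivity)]
  have hβ_le : β ≤ Real.pi / 2 := hβ ▸ Real.arcsin_le_pi_div_two _
  have hmono : Real.sin (α - β) ≤ (s + sdd - φ) / R := by
    rw [← Real.sin_arcsin (x := (s + sdd - φ) / R)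
      (by rw [le_div_iff₀ hRpos]; linarith) (by rwa [div_le_one hRpos])]
    exact Real.sin_le_sin_of_le_of_le_pi_div_two (by linarith)
      (Real.arcsin_le_pi_div_two _) (by linarith)
  have harc : sd * Real.sin α + sdd * Real.cos α = Real.sin (α - β) * R := by
    rw [Real.sin_sub, hsin, hcos]
    field_simp
    ring
  rw [le_div_iff₀ hRpos] at hmono
  linarith
end

section
/- Let s, ṡ, s̈, φ be real numbers with ṡ < 0, s̈ < 0, s ≥ φ, and s + s̈ − φ ≤ 0. Let R = √(ṡ² + s̈²) and β = arcsin(−s̈/R). Then for every α ∈ [0, π − arcsin(−(s + s̈ − φ)/R) − β], we have s − ṡ·sin α + s̈·(1 − cos α) ≥ φ. -/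
/-- The sine is at least `sin a` on the interval `[a, π - a]`, for `a ≥ -π / 2`. -/
theorem sin_le_sin_of_mem_Icc_pi_sub {a x : ℝ} (ha : -(Real.pi / 2) ≤ a)
    (hx : x ∈ Set.Icc a (Real.pi - a)) : Real.sin a ≤ Real.sin x := by
  obtain ⟨hax, hxa⟩ := hx
  rcases le_total x (Real.pi / 2) with h | h
  · exact Real.sin_le_sin_of_le_of_le_pi_div_two ha h hax
  · rw [← Real.sin_pi_sub x]
    exact Real.sin_le_sin_of_le_of_le_pi_div_two ha (by linarith) (by linarith)

/-- Case 5a of the appendix: step sizes guaranteeing `s(α) ≥ φ` along the arc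
when `ṡ < 0` and `s̈ < 0`. -/
theorem arc_positivity_case5a (s sd sdd φ : ℝ) (hsd : sd < 0) (hsdd : sdd < 0)
    (hs : s ≥ φ) (hle : s + sdd - φ ≤ 0)
    (R : ℝ) (hR : R = Real.sqrt (sd ^ 2 + sdd ^ 2))
    (β : ℝ) (hβ : β = Real.arcsin (-sdd / R)) :
    ∀ α ∈ Set.Icc (0 : ℝ) (Real.pi - Real.arcsin (-(s + sdd - φ) / R) - β),
      s - sd * Real.sin α + sdd * (1 - Real.cos α) ≥ φ := by
  rintro α ⟨hα0, hα1⟩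
  have hRpos : 0 < R := hR ▸ Real.sqrt_pos.2 (by nlinarith)
  have hRsq : R ^ 2 = sd ^ 2 + sdd ^ 2 := hR ▸ Real.sq_sqrt (by positivity)
  have hdR : -sdd / R ≤ 1 := (div_le_one hRpos).2 (by nlinarith)
  have hd0 : 0 ≤ -sdd / R := div_nonneg (by linarith) hRpos.le
  have hc0 : 0 ≤ -(s + sdd - φ) / R := div_nonneg (by linarith) hRpos.le
  have hcd : -(s + sdd - φ) / R ≤ -sdd / R := by gcongr; linarith
  have hsinβ : Real.sin β = -sdd / R := by
    rw [hβ, Real.sin_arcsin (by linarith) hdR]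
  have hcosβ : Real.cos β = -sd / R := by
    have hsq : 1 - (-sdd / R) ^ 2 = (-sd / R) ^ 2 := by
      field_simp
      linarith
    rw [hβ, Real.cos_arcsin, hsq, Real.sqrt_sq (div_nonneg (by linarith) hRpos.le)]
  have hγβ : Real.arcsin (-(s + sdd - φ) / R) ≤ β := hβ ▸ Real.monotone_arcsin hcd
  have hsin := sin_le_sin_of_mem_Icc_pi_sub (x := α + β)
    (Real.neg_pi_div_two_le_arcsin (-(s + sdd - φ) / R)) ⟨by linarith, by linarith⟩
  rw [Real.sin_arcsin (by linarith) (by linarith), Real.sin_add, hsinβ, hcosβ,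
    div_le_iff₀ hRpos] at hsin
  have hRarc : (Real.sin α * (-sd / R) + Real.cos α * (-sdd / R)) * R =
      -sd * Real.sin α - sdd * Real.cos α := by
    field_simp
    ring
  linarith
end
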